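/- arXiv:2212.03743 — 2 statements merged into one kernel-verified Lean document; each statement's English description precedes it below -/
import Mathlib

section
/- Let m ≥ 0, n ≥ m+1, let k ∈ {0,…,2^{m+1}−1}, and let π : ℕ → ℝ be any function. For x ∈ {0,…,2^n−1} let N_k(x) = #{ t ∈ {0,…,n−m−1} : ⌊x/2^t⌋ mod 2^{m+1} = k } be the number of positions at which the (m+1)-bit pattern k occurs in the n-bit expansion of x. Then Σ_{x=0}^{2^n−1} N_k(x)·π(x) = Σ_{i=0}^{n−m−1} Σ_{j=0}^{2^{n−m−1}−1} π( 2^{m+1}·j + 2^i·k − (2^{m+1}−1)·(j mod 2^i) ). (Note 2^{m+1}·j ≥ (2^{m+1}−1)·(j mod 2^i), so the argument of π is a natural number, and it is always < 2^n.) -/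
/-- For `q = j / P` and `r = j % P`, the number `M * j + P * k - (M - 1) * (j % P)` has
quotient digit `q`, middle digit `k` and remainder `r` in mixed radix `(M, P)`. -/
theorem mul_add_mul_sub_mul_mod {M : ℕ} (hM : 0 < M) (P k j : ℕ) :
    M * j + P * k - (M - 1) * (j % P) = P * (M * (j / P) + k) + j % P := by
  obtain ⟨N, rfl⟩ : ∃ N, M = N + 1 := ⟨M - 1, by lia⟩
  rw [Nat.add_sub_cancel]
  apply Nat.sub_eq_of_eq_add
  conv_lhs => rw [← Nat.div_add_mod j P]
  ring

/-- Summing over the numbers below `M * (P * Q)` whose middle digit in mixed radix `(M, P)` is `k`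
amounts to summing over the remaining digits. -/
theorem sum_filter_div_mod_eq {A : Type*} [AddCommMonoid A] {M P : ℕ} (Q : ℕ) {k : ℕ}
    (hP : 0 < P) (hk : k < M) (f : ℕ → A) :
    ∑ x ∈ Finset.range (M * (P * Q)) with x / P % M = k, f x =
      ∑ j ∈ Finset.range (P * Q), f (M * j + P * k - (M - 1) * (j % P)) := by
  have hM : 0 < M := by lia
  simp only [mul_add_mul_sub_mul_mod hM]
  have div_eq (a r : ℕ) (hr : r < P) : (P * a + r) / P = a := by
    rw [Nat.mul_add_div hP, Nat.div_eq_of_lt hr, add_zero]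
  have mod_eq (a r : ℕ) (hr : r < P) : (P * a + r) % P = r := by
    rw [Nat.mul_add_mod, Nat.mod_eq_of_lt hr]
  have lt_iff (a r b : ℕ) (hr : r < P) : P * a + r < P * b ↔ a < b := by
    rw [mul_comm P b, ← Nat.div_lt_iff_lt_mul hP, div_eq a r hr]
  symm
  refine Finset.sum_nbij' (fun j => P * (M * (j / P) + k) + j % P)
    (fun x => P * (x / P / M) + x % P) ?_ ?_ ?_ ?_ fun _ _ => rfl
  · intro j hj
    have hr := Nat.mod_lt j hP
    rw [Finset.mem_range, ← Nat.div_add_mod j P, lt_iff _ _ _ hr] at hj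
    rw [Finset.mem_filter, Finset.mem_range, div_eq _ _ hr, Nat.mul_add_mod,
      Nat.mod_eq_of_lt hk, mul_left_comm, lt_iff _ _ _ hr]
    refine ⟨?_, rfl⟩
    nlinarith [Nat.mul_le_mul_left M hj]
  · intro x hx
    have hr := Nat.mod_lt x hP
    rw [Finset.mem_filter, Finset.mem_range] at hx
    rw [Finset.mem_range, lt_iff _ _ _ hr, Nat.div_lt_iff_lt_mul hM, Nat.div_lt_iff_lt_mul hP]
    linarith [hx.1]
  · intro j _
    have hr := Nat.mod_lt j hP
    simp only [div_eq _ _ hr, mod_eq _ _ hr, Nat.mul_add_div hM, Nat.div_eq_of_lt hk, add_zero,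
      Nat.div_add_mod]
  · intro x hx
    have hr := Nat.mod_lt x hP
    rw [Finset.mem_filter] at hx
    simp only [div_eq _ _ hr, mod_eq _ _ hr]
    rw [← hx.2, Nat.div_add_mod, Nat.div_add_mod]

/-- **Combinatorial core of Theorem 3.3.**
For `n ≥ m+1`, `k < 2^{m+1}` and any `π : ℕ → ℝ`, with
`N_k(x) = #{ t < n-m : ⌊x/2^t⌋ mod 2^{m+1} = k }` the number of occurrences of
the (m+1)-bit pattern `k` in the n-bit expansion of `x`:
`∑_{x=0}^{2^n-1} N_k(x) π(x)
  = ∑_{i=0}^{n-m-1} ∑_{j=0}^{2^{n-m-1}-1} π(2^{m+1} j + 2^i k - (2^{m+1}-1)(j mod 2^i))`. -/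
theorem pattern_count_sum
    (m n : ℕ) (hn : m + 1 ≤ n) (k : ℕ) (hk : k < 2 ^ (m + 1)) (π : ℕ → ℝ) :
    (∑ x ∈ Finset.range (2 ^ n),
      (((Finset.range (n - m)).filter (fun t => (x / 2 ^ t) % 2 ^ (m + 1) = k)).card : ℝ)
        * π x) =
    ∑ i ∈ Finset.range (n - m), ∑ j ∈ Finset.range (2 ^ (n - m - 1)),
      π (2 ^ (m + 1) * j + 2 ^ i * k - (2 ^ (m + 1) - 1) * (j % 2 ^ i)) := by
  simp_rw [← nsmul_eq_mul, ← Finset.sum_const, Finset.sum_filter]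
  rw [Finset.sum_comm]
  refine Finset.sum_congr rfl fun i hi => ?_
  rw [Finset.mem_range] at hi
  have hN : 2 ^ (n - m - 1) = 2 ^ i * 2 ^ (n - m - 1 - i) := by
    rw [← pow_add]
    congr 1
    lia
  have hn' : 2 ^ n = 2 ^ (m + 1) * 2 ^ (n - m - 1) := by
    rw [← pow_add]
    congr 1
    lia
  rw [← Finset.sum_filter, hn', hN]
  exact sum_filter_div_mod_eq _ (Nat.two_pow_pos i) hk π
end

section
/- Let m ≥ 1, n ≥ m+1, let π^n be a probability mass function on {0,…,2^n−1}, let k ∈ {0,…,2^{m+1}−1}, and let p = (p_0,…,p_{2^{m+1}−1}) be positive reals. For x ∈ {0,…,2^n−1} let N_j(x) = #{ t ∈ {0,…,n−m−1} : ⌊x/2^t⌋ mod 2^{m+1} = j }, and define the log-likelihood in the single parameter t > 0 by ℓ_x(t) = N_k(x)·log t + Σ_{j ≠ k} N_j(x)·log p_j. Then the Fisher information I(p_k) := − Σ_{x=0}^{2^n−1} π^n(x) · ℓ_x''(p_k) satisfies I(p_k) = (1/p_k^2) · Σ_{i=0}^{n−m−1} Σ_{j=0}^{2^{n−m−1}−1}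 π^n( 2^{m+1}·j + 2^i·k − (2^{m+1}−1)·(j mod 2^i) ), where ℓ_x'' denotes the second derivative of ℓ_x. -/
/-- Closed form of the number obtained from `j` by inserting the base-`M` digit `k` just above the
lowest base-`A` digit. -/
theorem insert_digit_eq {M A k j : ℕ} (hM : 0 < M) :
    M * j + A * k - (M - 1) * (j % A) = A * (M * (j / A) + k) + j % A := by
  obtain ⟨M, rfl⟩ : ∃ M', M = M' + 1 := ⟨M - 1, by omega⟩
  rw [Nat.add_sub_cancel]
  apply Nat.sub_eq_of_eq_add
  conv_lhs => rw [← Nat.div_add_mod j A]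
  ring

/-- Summing over the numbers below `A * M * C` whose middle digit is `k` amounts to summing over
the numbers below `A * C` and inserting the digit `k`. -/
theorem sum_filter_middle_digit {α : Type*} [AddCommMonoid α] (f : ℕ → α) {M A C k : ℕ}
    (hA : 0 < A) (hk : k < M) :
    ∑ x ∈ (Finset.range (A * M * C)).filter (fun x => x / A % M = k), f x =
      ∑ j ∈ Finset.range (A * C), f (M * j + A * k - (M - 1) * (j % A)) := by
  have hM : 0 < M := Nat.zero_lt_of_lt hk
  simp_rw [insert_digit_eq hM]
  have hdiv : ∀ a b : ℕ, (A * a + b % A) / A = a := fun a b => by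
    rw [Nat.mul_add_div hA, Nat.div_eq_of_lt (Nat.mod_lt _ hA), add_zero]
  have hmod : ∀ a b : ℕ, (A * a + b % A) % A = b % A := fun a b => by
    rw [Nat.mul_add_mod, Nat.mod_mod]
  refine Finset.sum_nbij' (fun x => A * (x / A / M) + x % A)
    (fun j => A * (M * (j / A) + k) + j % A) ?_ ?_ ?_ ?_ ?_
  · intro x hx
    simp only [Finset.mem_filter, Finset.mem_range] at hx ⊢
    rw [mul_comm A C, ← Nat.div_lt_iff_lt_mul hA, hdiv, Nat.div_div_eq_div_mul]
    exact Nat.div_lt_of_lt_mul hx.1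
  · intro j hj
    simp only [Finset.mem_filter, Finset.mem_range] at hj ⊢
    refine ⟨?_, by rw [hdiv, Nat.mul_add_mod, Nat.mod_eq_of_lt hk]⟩
    rw [mul_assoc, mul_comm A (M * C), ← Nat.div_lt_iff_lt_mul hA, hdiv, mul_comm M C,
      ← Nat.div_lt_iff_lt_mul hM, Nat.mul_add_div hM, Nat.div_eq_of_lt hk, add_zero]
    exact Nat.div_lt_of_lt_mul hj
  · intro x hx
    simp only [Finset.mem_filter, Finset.mem_range] at hx
    simp only [hdiv, hmod]
    rw [← hx.2, Nat.div_add_mod, Nat.div_add_mod]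
  · intro j _
    simp only [hdiv, hmod]
    rw [Nat.mul_add_div hM, Nat.div_eq_of_lt hk, add_zero, Nat.div_add_mod]
  · intro x hx
    simp only [Finset.mem_filter, Finset.mem_range] at hx
    simp only [hdiv, hmod]
    rw [← hx.2, Nat.div_add_mod, Nat.div_add_mod]

theorem deriv_deriv_mul_log_add (a c x : ℝ) :
    deriv (deriv fun t : ℝ => a * Real.log t + c) x = -(1 / x ^ 2 * a) := by
  have h : (deriv fun t : ℝ => a * Real.log t + c) = fun t => a * t⁻¹ := by
    ext t
    rw [deriv_add_const, deriv_const_mul_field, Real.deriv_log]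
  rw [h, deriv_const_mul_field, deriv_inv]
  ring


/-- **Theorem 3.3 (Fisher information, general m).**
With `N_j(x)` the number of occurrences of the (m+1)-bit pattern `j` in the
n-bit expansion of `x`, the log-likelihood in the single parameter `t` is
`ℓ_x(t) = N_k(x) log t + ∑_{j ≠ k} N_j(x) log p_j`.  The Fisher information
`I(p_k) = -∑_x πⁿ(x) ℓ_x''(p_k)` equals
`(1/p_k²) ∑_{i=0}^{n-m-1} ∑_{j=0}^{2^{n-m-1}-1}
   πⁿ(2^{m+1} j + 2^i k - (2^{m+1}-1)(j mod 2^i))`. -/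
theorem fisher_information_deBruijn
    (m n : ℕ) (hm : 1 ≤ m) (hn : m + 1 ≤ n)
    (π : ℕ → ℝ) (hπ : ∀ x, 0 ≤ π x)
    (hπ1 : (∑ x ∈ Finset.range (2 ^ n), π x) = 1)
    (k : ℕ) (hk : k < 2 ^ (m + 1))
    (p : ℕ → ℝ) (hp : ∀ j < 2 ^ (m + 1), 0 < p j)
    (N : ℕ → ℕ → ℕ)
    (hN : ∀ j x, N j x =
      ((Finset.range (n - m)).filter (fun t => (x / 2 ^ t) % 2 ^ (m + 1) = j)).card) :
    (- ∑ x ∈ Finset.range (2 ^ n),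
        π x *
          deriv (deriv (fun t : ℝ =>
            (N k x : ℝ) * Real.log t +
              ∑ j ∈ (Finset.range (2 ^ (m + 1))).erase k,
                (N j x : ℝ) * Real.log (p j))) (p k)) =
      (1 / (p k) ^ 2) *
        ∑ i ∈ Finset.range (n - m), ∑ j ∈ Finset.range (2 ^ (n - m - 1)),
          π (2 ^ (m + 1) * j + 2 ^ i * k - (2 ^ (m + 1) - 1) * (j % 2 ^ i)) := by
  simp_rw [deriv_deriv_mul_log_add, mul_neg, Finset.sum_neg_distrib, neg_neg,
    mul_left_comm _ (1 / p k ^ 2),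
    ← Finset.mul_sum]
  congr 1
  simp_rw [hN, Finset.card_filter, Nat.cast_sum, Finset.mul_sum]
  rw [Finset.sum_comm]
  refine Finset.sum_congr rfl fun i hi => ?_
  have hi' : i < n - m := Finset.mem_range.mp hi
  have h := sum_filter_middle_digit π (C := 2 ^ (n - m - 1 - i)) (Nat.two_pow_pos i) hk
  rw [← pow_add, ← pow_add, ← pow_add, show i + (m + 1) + (n - m - 1 - i) = n by omega,
    show i + (n - m - 1 - i) = n - m - 1 by omega] at h
  rw [← h, Finset.sum_filter]
  exact Finset.sum_congr rfl fun x _ => by simp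
end
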